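/- If σ_r := u_1⋯u_r is invertible in R, then the trace form τ is symmetrizing: the R-bilinear form H_{n,r} × H_{n,r} → R, (x, y) ↦ τ(xy), is non-degenerate. -/

import Mathlib

open Polynomial

namespace MAK

noncomputable section

variable (R : Type*) [CommRing R] (n r : ℕ) (q Δ : Rˣ) (u : Fin r → R) (F : Fin r → R[X])

/-- The free `R`-algebra on generators `t_1, …, t_n` (left) and `T_1, …, T_{n-1}` (right). -/
abbrev FA := FreeAlgebra R (Fin n ⊕ Fin (n - 1))

/-- The generators `t_i`. -/
def tf (i : Fin n) : FA R n := FreeAlgebra.ι R (Sum.inl i)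

/-- The generators `T_j`. -/
def Tf (j : Fin (n - 1)) : FA R n := FreeAlgebra.ι R (Sum.inr j)

/-- The index `j`, viewed in `Fin n`. -/
def lo (j : Fin (n - 1)) : Fin n := ⟨j.1, by have := j.2; omega⟩

/-- The index `j + 1`, viewed in `Fin n`. -/
def hi (j : Fin (n - 1)) : Fin n := ⟨j.1 + 1, by have := j.2; omega⟩

/-- The element `B_j = Δ⁻² Σ_{c1<c2} (u_{c2} - u_{c1})(q - q⁻¹) F_{c1}(t_j) F_{c2}(t_{j+1})`. -/
def Bel (j : Fin (n - 1)) : FA R n :=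
  ∑ c2 : Fin r, ∑ c1 ∈ Finset.univ.filter (fun c1 => c1 < c2),
    (((Δ⁻¹ : Rˣ) : R) ^ 2 * ((u c2 - u c1) * ((q : R) - ((q⁻¹ : Rˣ) : R)))) •
      (aeval (tf R n (lo n j)) (F c1) * aeval (tf R n (hi n j)) (F c2))

/-- The defining relations of the modified Ariki-Koike algebra. -/
inductive Rel : FA R n → FA R n → Prop
  | quad (j : Fin (n - 1)) :
      Rel ((Tf R n j - algebraMap R (FA R n) (q : R)) *
        (Tf R n j + algebraMap R (FA R n) ((q⁻¹ : Rˣ) : R))) 0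
  | tord (i : Fin n) : Rel (aeval (tf R n i) (∏ c : Fin r, (X - C (u c)))) 0
  | braid (j k : Fin (n - 1)) (h : k.1 = j.1 + 1) :
      Rel (Tf R n j * Tf R n k * Tf R n j) (Tf R n k * Tf R n j * Tf R n k)
  | Tcomm (j k : Fin (n - 1)) (h : j.1 + 2 ≤ k.1 ∨ k.1 + 2 ≤ j.1) :
      Rel (Tf R n j * Tf R n k) (Tf R n k * Tf R n j)
  | tcomm (i i' : Fin n) : Rel (tf R n i * tf R n i') (tf R n i' * tf R n i)
  | Tt (j : Fin (n - 1)) (i : Fin n) (h1 : i ≠ lo n j) (h2 : i ≠ hi n j) :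
      Rel (Tf R n j * tf R n i) (tf R n i * Tf R n j)
  | Thi (j : Fin (n - 1)) :
      Rel (Tf R n j * tf R n (hi n j)) (tf R n (lo n j) * Tf R n j + Bel R n r q Δ u F j)
  | Tlo (j : Fin (n - 1)) :
      Rel (Tf R n j * tf R n (lo n j)) (tf R n (hi n j) * Tf R n j - Bel R n r q Δ u F j)

/-- The modified Ariki-Koike algebra `H_{n,r}(R, q, u_1, …, u_r)`. -/
abbrev Hnr := RingQuot (Rel R n r q Δ u F)

/-- The canonical projection. -/
def pim : FA R n →ₐ[R] Hnr R n r q Δ u F := RingQuot.mkAlgHom R (Rel R n r q Δ u F)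

/-- The generator `t_i` of `H_{n,r}`. -/
def tt (i : Fin n) : Hnr R n r q Δ u F := pim R n r q Δ u F (tf R n i)

/-- The generator `T_j` of `H_{n,r}`. -/
def TT (j : Fin (n - 1)) : Hnr R n r q Δ u F := pim R n r q Δ u F (Tf R n j)

/-- The Lagrange basis polynomial `∏_{j ≠ c} (X - u_j)/(u_c - u_j)`. -/
def bpoly (c : Fin r) : R[X] :=
  ∏ j ∈ Finset.univ.filter (fun j => j ≠ c), Ring.inverse (u c - u j) • (X - C (u j))

/-- The idempotent `b_{k_1, …, k_n}`. -/
def b (k : Fin n → Fin r) : Hnr R n r q Δ u F :=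
  (List.ofFn fun i : Fin n => aeval (tt R n r q Δ u F i) (bpoly R r u (k i))).prod

/-- The element `B'_{i,j} = -(q - q⁻¹) Σ_{k_i < k_j} b_{k_1, …, k_n}`. -/
def B' (i j : Fin n) : Hnr R n r q Δ u F :=
  -(((q : R) - ((q⁻¹ : Rˣ) : R)) •
    ∑ k ∈ Finset.univ.filter (fun k : Fin n → Fin r => k i < k j), b R n r q Δ u F k)

/-- The element `g_i := T_i + B'_{i,i+1}`. -/
def g (j : Fin (n - 1)) : Hnr R n r q Δ u F :=
  TT R n r q Δ u F j + B' R n r q Δ u F (lo n j) (hi n j)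

/-- The idempotent `e_{i,j} = Σ_{k_i = k_j} b_{k_1, …, k_n}`. -/
def eij (i j : Fin n) : Hnr R n r q Δ u F :=
  ∑ k ∈ Finset.univ.filter (fun k : Fin n → Fin r => k i = k j), b R n r q Δ u F k

/-- The idempotent `e_i = e_{i,i+1}`. -/
def ee (j : Fin (n - 1)) : Hnr R n r q Δ u F := eij R n r q Δ u F (lo n j) (hi n j)

/-- The simple transposition `s_j = (j, j+1)` in `S_n`. -/
def simple (j : Fin (n - 1)) : Equiv.Perm (Fin n) := Equiv.swap (lo n j) (hi n j)

/-- `l` is a reduced word for the permutation `w`. -/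
def IsReducedWord (w : Equiv.Perm (Fin n)) (l : List (Fin (n - 1))) : Prop :=
  (l.map (simple n)).prod = w ∧
    ∀ l' : List (Fin (n - 1)), (l'.map (simple n)).prod = w → l.length ≤ l'.length

/-- The element `g_w = g_{i_1} ⋯ g_{i_l}` associated to a word `l = (i_1, …, i_l)`. -/
def gword (l : List (Fin (n - 1))) : Hnr R n r q Δ u F := (l.map (g R n r q Δ u F)).prod

/-- The element `T_w = T_{i_1} ⋯ T_{i_l}` associated to a word `l = (i_1, …, i_l)`. -/
def Tword (l : List (Fin (n - 1))) : Hnr R n r q Δ u F := (l.map (TT R n r q Δ u F)).prod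

/-- The monomial `t_1^{c_1} ⋯ t_n^{c_n}`. -/
def tmon (c : Fin n → ℕ) : Hnr R n r q Δ u F :=
  (List.ofFn fun i : Fin n => tt R n r q Δ u F i ^ c i).prod

end

end MAK

open MAK

namespace MAK

section Words

/-- The descending word `j + k - 1, …, j + 1, j`. -/
def descWord (j k : ℕ) : List ℕ := (List.range' j k).reverse

lemma descWord_succ (j k : ℕ) : descWord j (k + 1) = (j + k) :: descWord j k := by
  simp [descWord, List.range'_concat]

lemma descWord_succ' (j k : ℕ) : descWord j (k + 1) = descWord (j + 1) k ++ [j] := by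
  simp [descWord, List.range'_succ]

lemma mem_descWord {j k x : ℕ} : x ∈ descWord j k ↔ j ≤ x ∧ x < j + k := by
  simp [descWord, List.mem_range'_1]

/-- Normal form words for permutations, using only letters below `m`. -/
def normalWords : ℕ → Set (List ℕ)
  | 0 => {[]}
  | m + 1 => {w | ∃ l ∈ normalWords m, ∃ j ≤ m + 1, w = l ++ descWord j (m + 1 - j)}

lemma nil_mem_normalWords (m : ℕ) : [] ∈ normalWords m := by
  induction m with
  | zero => rfl
  | succ m ih => exact ⟨[], ih, m + 1, le_rfl, by simp [descWord]⟩

lemma lt_of_mem_normalWords {m : ℕ} {l : List ℕ} (hl : l ∈ normalWords m) :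
    ∀ x ∈ l, x < m := by
  induction m generalizing l with
  | zero =>
    obtain rfl : l = [] := hl
    simp
  | succ m ih =>
    obtain ⟨l, hl, j, hj, rfl⟩ := hl
    intro x hx
    rcases List.mem_append.1 hx with hx | hx
    · exact (ih hl x hx).trans (Nat.lt_succ_self m)
    · have := mem_descWord.1 hx
      omega

variable {M : Type*} [Monoid M] (g : ℕ → M)

/-- The product of the values of `g` along a word. -/
def wordProd (l : List ℕ) : M := (l.map g).prod

@[simp] lemma wordProd_nil : wordProd g [] = 1 := rfl

@[simp] lemma wordProd_cons (i : ℕ) (l : List ℕ) :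
    wordProd g (i :: l) = g i * wordProd g l := by
  simp [wordProd]

@[simp] lemma wordProd_append (l l' : List ℕ) :
    wordProd g (l ++ l') = wordProd g l * wordProd g l' := by
  simp [wordProd]

lemma wordProd_mul_comm {l : List ℕ} {x : M} (h : ∀ i ∈ l, g i * x = x * g i) :
    wordProd g l * x = x * wordProd g l := by
  induction l with
  | nil => simp
  | cons i l ih =>
    rw [wordProd_cons, mul_assoc, ih fun k hk => h k (List.mem_cons_of_mem _ hk), ← mul_assoc,
      h i (List.mem_cons_self ..), mul_assoc]

/-- The first `N` values of `g` satisfy the braid relations of type `A`. -/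
structure BraidRel (N : ℕ) : Prop where
  braid : ∀ i, i + 1 < N → g i * g (i + 1) * g i = g (i + 1) * g i * g (i + 1)
  comm : ∀ i j, i + 2 ≤ j → j < N → g i * g j = g j * g i

variable {g}

lemma BraidRel.descWord_mul {N : ℕ} (h : BraidRel g N) {j k i : ℕ} (hk : j + k ≤ N) (hj : j ≤ i)
    (hi : i + 1 < j + k) :
    wordProd g (descWord j k) * g (i + 1) = g i * wordProd g (descWord j k) := by
  induction k with
  | zero => omega
  | succ k ih =>
    rw [descWord_succ, wordProd_cons]
    rcases Nat.lt_or_ge (i + 1) (j + k) with hik | hik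
    · rw [mul_assoc, ih (by omega) hik, ← mul_assoc, ← mul_assoc,
        h.comm i (j + k) (by omega) (by omega)]
    · obtain ⟨k, rfl⟩ : ∃ k', k = k' + 1 := ⟨k - 1, by omega⟩
      obtain rfl : i = j + k := by omega
      have hcomm : wordProd g (descWord j k) * g (j + k + 1)
          = g (j + k + 1) * wordProd g (descWord j k) := by
        refine wordProd_mul_comm g fun x hx => ?_
        have := mem_descWord.1 hx
        exact h.comm _ _ (by omega) (by omega)
      rw [descWord_succ, wordProd_cons, ← add_assoc, mul_assoc, mul_assoc, hcomm,
        ← mul_assoc, ← mul_assoc, ← h.braid _ (by omega)]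
      simp only [mul_assoc]

/-- Multiplying a normal form word on the right by a letter gives, up to the braid relations,
a normal form word which is longer or shorter by one letter. -/
lemma BraidRel.exists_normalWord {N : ℕ} (h : BraidRel g N) {m : ℕ} (hm : m ≤ N) {l : List ℕ}
    (hl : l ∈ normalWords m) {i : ℕ} (hi : i < m) :
    ∃ l' ∈ normalWords m,
      (wordProd g l' = wordProd g l * g i ∧ l'.length = l.length + 1) ∨
      (wordProd g l = wordProd g l' * g i ∧ l.length = l'.length + 1) := by
  induction m generalizing l i with
  | zero => omega
  | succ m ih =>
    obtain ⟨l, hl, j, hj, rfl⟩ := hl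
    have key : ∀ i', i' < m → wordProd g (descWord j (m + 1 - j)) * g i
        = g i' * wordProd g (descWord j (m + 1 - j)) →
        ∃ l' ∈ normalWords (m + 1),
          (wordProd g l' = wordProd g (l ++ descWord j (m + 1 - j)) * g i ∧
            l'.length = (l ++ descWord j (m + 1 - j)).length + 1) ∨
          (wordProd g (l ++ descWord j (m + 1 - j)) = wordProd g l' * g i ∧
            (l ++ descWord j (m + 1 - j)).length = l'.length + 1) := by
      intro i' hi' hcomm
      obtain ⟨l', hl', hll'⟩ := ih (by omega) hl hi'
      refine ⟨l' ++ descWord j (m + 1 - j), ⟨l', hl', j, hj, rfl⟩, ?_⟩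
      simp only [wordProd_append, List.length_append, mul_assoc, hcomm]
      rcases hll' with ⟨h1, h2⟩ | ⟨h1, h2⟩
      · exact Or.inl ⟨by rw [h1, mul_assoc], by omega⟩
      · exact Or.inr ⟨by rw [h1, mul_assoc], by omega⟩
    rcases Nat.lt_trichotomy (i + 1) j with hij | hij | hij
    · refine key i (by omega) (wordProd_mul_comm g fun x hx => ?_)
      have := mem_descWord.1 hx
      exact (h.comm _ _ (by omega) (by omega)).symm
    · subst hij
      refine ⟨l ++ descWord i (m + 1 - i), ⟨l, hl, i, by omega, rfl⟩, Or.inl ?_⟩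
      rw [show m + 1 - i = (m + 1 - (i + 1)) + 1 by omega, descWord_succ']
      exact ⟨by simp [mul_assoc], by simp; omega⟩
    · rcases Nat.eq_or_lt_of_le (Nat.lt_succ_iff.1 hij) with hij | hij
      · subst hij
        refine ⟨l ++ descWord (j + 1) (m + 1 - (j + 1)), ⟨l, hl, j + 1, by omega, rfl⟩,
          Or.inr ?_⟩
        rw [show m + 1 - j = (m + 1 - (j + 1)) + 1 by omega, descWord_succ']
        exact ⟨by simp [mul_assoc], by simp; omega⟩
      · obtain ⟨i, rfl⟩ : ∃ i', i = i' + 1 := ⟨i - 1, by omega⟩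
        exact key i (by omega) (h.descWord_mul (by omega) (by omega) (by omega))

end Words

section NatPerm

/-- The adjacent transposition `(i, i + 1)` of `ℕ`. -/
def natSwap (i : ℕ) : Equiv.Perm ℕ := Equiv.swap i (i + 1)

lemma wordProd_natSwap_apply_of_lt {l : List ℕ} {m x : ℕ} (hl : ∀ i ∈ l, i < m) (hx : m < x) :
    wordProd natSwap l x = x := by
  induction l with
  | nil => rfl
  | cons i l ih =>
    have hi : i < m := hl i (List.mem_cons_self ..)
    rw [wordProd_cons, Equiv.Perm.mul_apply, ih fun k hk => hl k (List.mem_cons_of_mem _ hk),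
      natSwap, Equiv.swap_apply_of_ne_of_ne (by omega) (by omega)]

lemma wordProd_natSwap_descWord (j k : ℕ) : wordProd natSwap (descWord j k) j = j + k := by
  induction k with
  | zero => rfl
  | succ k ih =>
    rw [descWord_succ, wordProd_cons, Equiv.Perm.mul_apply, ih, natSwap, Equiv.swap_apply_left,
      add_assoc]

lemma normalWords_injOn (m : ℕ) : Set.InjOn (wordProd natSwap) (normalWords m) := by
  induction m with
  | zero =>
    intro l hl l' hl' _
    exact (show l = [] from hl).trans (show l' = [] from hl').symm
  | succ m ih =>
    rintro _ ⟨l, hl, j, hj, rfl⟩ _ ⟨l', hl', j', hj', rfl⟩ h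
    have aux : ∀ l ∈ normalWords m, ∀ j ≤ m + 1,
        wordProd natSwap (l ++ descWord j (m + 1 - j)) j = m + 1 := by
      intro l hl j hj
      rw [wordProd_append, Equiv.Perm.mul_apply, wordProd_natSwap_descWord,
        Nat.add_sub_cancel' hj,
        wordProd_natSwap_apply_of_lt (lt_of_mem_normalWords hl) (Nat.lt_succ_self m)]
    have hjj : j = j' := by
      apply (wordProd natSwap (l ++ descWord j (m + 1 - j))).injective
      rw [aux l hl j hj, h, aux l' hl' j' hj']
    subst hjj
    rw [wordProd_append, wordProd_append, mul_left_inj] at h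
    rw [ih hl hl' h]

end NatPerm

section FinWords

variable {n : ℕ}

lemma simple_apply_val (j : Fin (n - 1)) (x : Fin n) :
    (simple n j x).val = natSwap j.val x.val := by
  unfold simple natSwap lo hi
  rw [Equiv.swap_apply_def, Equiv.swap_apply_def]
  simp only [Fin.ext_iff]
  split_ifs <;> rfl

lemma prod_simple_apply_val (l : List (Fin (n - 1))) (x : Fin n) :
    ((l.map (simple n)).prod x).val = wordProd natSwap (l.map Fin.val) x.val := by
  induction l with
  | nil => rfl
  | cons j l ih => simp [simple_apply_val, ih]

lemma wordProd_natSwap_eq {l l' : List (Fin (n - 1))}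
    (h : (l.map (simple n)).prod = (l'.map (simple n)).prod) :
    wordProd natSwap (l.map Fin.val) = wordProd natSwap (l'.map Fin.val) := by
  ext x
  rcases Nat.lt_or_ge x n with hx | hx
  · rw [← prod_simple_apply_val l ⟨x, hx⟩, ← prod_simple_apply_val l' ⟨x, hx⟩, h]
  · have aux : ∀ l : List (Fin (n - 1)), wordProd natSwap (l.map Fin.val) x = x := by
      intro l
      induction l with
      | nil => rfl
      | cons j l ih =>
        have := j.2
        rw [List.map_cons, wordProd_cons, Equiv.Perm.mul_apply, ih, natSwap,
          Equiv.swap_apply_of_ne_of_ne (by omega) (by omega)]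
    rw [aux, aux]

lemma simple_braid (j k : Fin (n - 1)) (h : k.1 = j.1 + 1) :
    simple n j * simple n k * simple n j = simple n k * simple n j * simple n k := by
  have hlk : lo n k = hi n j := Fin.ext h
  have h1 : lo n j ≠ hi n j := by simp [lo, hi]
  have h2 : lo n j ≠ hi n k := by simp [lo, hi]; omega
  have h3 : hi n j ≠ hi n k := by simp [hi]; omega
  unfold simple
  rw [hlk, Equiv.swap_mul_swap_mul_swap h1 h2, Equiv.swap_comm (lo n j),
    Equiv.swap_comm (hi n j) (hi n k), Equiv.swap_mul_swap_mul_swap h3.symm h2.symm]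
  exact Equiv.swap_comm _ _

lemma simple_comm (j k : Fin (n - 1)) (h : j.1 + 2 ≤ k.1) :
    simple n j * simple n k = simple n k * simple n j := by
  refine (Equiv.Perm.Disjoint.commute ?_ : Commute (simple n j) (simple n k))
  unfold simple
  intro x
  rcases eq_or_ne x (lo n j) with rfl | h1
  · right; apply Equiv.swap_apply_of_ne_of_ne <;> simp [lo, hi, Fin.ext_iff] <;> omega
  rcases eq_or_ne x (hi n j) with rfl | h2
  · right; apply Equiv.swap_apply_of_ne_of_ne <;> simp [lo, hi, Fin.ext_iff] <;> omega
  exact Or.inl (Equiv.swap_apply_of_ne_of_ne h1 h2)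

/-- Normal form words for the elements of `S_n`. -/
def finNormalWords (n : ℕ) : Set (List (Fin (n - 1))) :=
  {l | l.map Fin.val ∈ normalWords (n - 1)}

lemma nil_mem_finNormalWords : [] ∈ finNormalWords n := nil_mem_normalWords _

lemma finNormalWords_inj {l l' : List (Fin (n - 1))} (hl : l ∈ finNormalWords n)
    (hl' : l' ∈ finNormalWords n) (h : (l.map (simple n)).prod = (l'.map (simple n)).prod) :
    l = l' :=
  List.map_injective_iff.2 Fin.val_injective
    (normalWords_injOn (n - 1) hl hl' (wordProd_natSwap_eq h))

variable {M : Type*} [Monoid M] {g : Fin (n - 1) → M}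

/-- Multiplying a normal form word on the right by a letter gives, up to the braid relations,
a normal form word which is longer or shorter by one letter. -/
lemma exists_finNormalWord
    (braid : ∀ j k : Fin (n - 1), k.1 = j.1 + 1 → g j * g k * g j = g k * g j * g k)
    (comm : ∀ j k : Fin (n - 1), j.1 + 2 ≤ k.1 → g j * g k = g k * g j)
    {l : List (Fin (n - 1))} (hl : l ∈ finNormalWords n) (i : Fin (n - 1)) :
    ∃ l' ∈ finNormalWords n,
      ((l'.map g).prod = (l.map g).prod * g i ∧
        (l'.map (simple n)).prod = (l.map (simple n)).prod * simple n i ∧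
        l'.length = l.length + 1) ∨
      ((l.map g).prod = (l'.map g).prod * g i ∧
        (l.map (simple n)).prod = (l'.map (simple n)).prod * simple n i ∧
        l.length = l'.length + 1) := by
  let G : ℕ → M × Equiv.Perm (Fin n) :=
    fun i => if h : i < n - 1 then (g ⟨i, h⟩, simple n ⟨i, h⟩) else 1
  have hG : ∀ i : Fin (n - 1), G i.val = (g i, simple n i) := fun i => by simp [G]
  have hprod : ∀ l : List (Fin (n - 1)), wordProd G (l.map Fin.val)
      = ((l.map g).prod, (l.map (simple n)).prod) := by
    intro l
    induction l with
    | nil => rfl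
    | cons i l ih => simp [ih, hG]
  have hbr : BraidRel G (n - 1) := by
    constructor
    · intro i hi
      have h1 := hG ⟨i, by omega⟩
      have h2 := hG ⟨i + 1, hi⟩
      simp only at h1 h2
      rw [h1, h2]
      exact Prod.ext (braid _ _ rfl) (simple_braid _ _ rfl)
    · intro i j hij hj
      have h1 := hG ⟨i, by omega⟩
      have h2 := hG ⟨j, hj⟩
      simp only at h1 h2
      rw [h1, h2]
      exact Prod.ext (comm _ _ hij) (simple_comm _ _ hij)
  obtain ⟨l', hl', hll'⟩ := hbr.exists_normalWord le_rfl hl i.2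
  lift l' to List (Fin (n - 1)) using fun x hx => lt_of_mem_normalWords hl' x hx
  refine ⟨l', hl', ?_⟩
  rw [hprod, hprod, hG] at hll'
  simpa [Prod.ext_iff, and_assoc] using hll'

lemma exists_finNormalWord_length_le (l : List (Fin (n - 1))) :
    ∃ l' ∈ finNormalWords n, (l'.map (simple n)).prod = (l.map (simple n)).prod ∧
      l'.length ≤ l.length := by
  induction l using List.reverseRecOn with
  | nil => exact ⟨[], nil_mem_finNormalWords, rfl, le_rfl⟩
  | append_singleton l i ih =>
    obtain ⟨l₁, hl₁, hp, hlen⟩ := ih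
    obtain ⟨l₂, hl₂, ⟨-, h, h'⟩ | ⟨-, h, h'⟩⟩ :=
      exists_finNormalWord (n := n) simple_braid simple_comm hl₁ i
    · exact ⟨l₂, hl₂, by simp [h, hp], by simp; omega⟩
    · refine ⟨l₂, hl₂, ?_, by simp; omega⟩
      rw [List.map_append, List.prod_append, ← hp, h]
      simp [mul_assoc, simple]

lemma isReducedWord_of_mem_finNormalWords {l : List (Fin (n - 1))} (hl : l ∈ finNormalWords n) :
    IsReducedWord n (l.map (simple n)).prod l := by
  refine ⟨rfl, fun l' h => ?_⟩
  obtain ⟨l'', hl'', hp, hlen⟩ := exists_finNormalWord_length_le l'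
  rwa [finNormalWords_inj hl hl'' (by rw [hp, h])]

end FinWords

end MAK

namespace MAK

section Pairing

lemma map_eq_sum_smul_single {R K N : Type*} [CommSemiring R] [AddCommMonoid N] [Module R N]
    [Fintype K] [DecidableEq K] (φ : (K → R) →ₗ[R] N) (f : K → R) :
    φ f = ∑ k, f k • φ (Pi.single k 1) := by
  have hf : f = ∑ k, f k • (Pi.single k 1 : K → R) := by
    ext a
    simp [Finset.sum_apply, Pi.single_apply]
  conv_lhs => rw [hf]
  simp

variable {R H K : Type*} [CommRing R] [Ring H] [Algebra R H] {n : ℕ}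
  {φ : (K → R) →ₐ[R] H} {g : Fin (n - 1) → H}

lemma exists_prod_mul_map (hφ : ∀ j f, ∃ f', g j * φ f = φ f' * g j) (l : List (Fin (n - 1)))
    (f : K → R) : ∃ f', (l.map g).prod * φ f = φ f' * (l.map g).prod := by
  induction l with
  | nil => exact ⟨f, by simp⟩
  | cons j l ih =>
    obtain ⟨f₁, h₁⟩ := ih
    obtain ⟨f₂, h₂⟩ := hφ j f₁
    exact ⟨f₂, by rw [List.map_cons, List.prod_cons, mul_assoc, h₁, ← mul_assoc, h₂, mul_assoc]⟩

lemma IsReducedWord.of_append_singleton {l : List (Fin (n - 1))} {i : Fin (n - 1)}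
    (h : IsReducedWord n ((l ++ [i]).map (simple n)).prod (l ++ [i])) :
    IsReducedWord n (l.map (simple n)).prod l := by
  refine ⟨rfl, fun l' hl' => ?_⟩
  have := h.2 (l' ++ [i]) (by simp [hl'])
  simpa using this

lemma simple_mul_self (i : Fin (n - 1)) : simple n i * simple n i = 1 :=
  Equiv.swap_mul_self _ _

/-- The words in the `g_j`, twisted by the diagonal subalgebra, are orthogonal for the trace. -/
lemma trace_prod_mul_prod_reverse
    (hφ : ∀ j f, ∃ f', g j * φ f = φ f' * g j)
    (quad : ∀ j, ∃ e, g j * g j = 1 + φ e * g j)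
    (braid : ∀ j k : Fin (n - 1), k.1 = j.1 + 1 → g j * g k * g j = g k * g j * g k)
    (comm : ∀ j k : Fin (n - 1), j.1 + 2 ≤ k.1 → g j * g k = g k * g j)
    (τ : H →ₗ[R] R) (ev : (K → R) → R)
    (hτ : ∀ l, IsReducedWord n (l.map (simple n)).prod l → ∀ f,
      τ (φ f * (l.map g).prod) = if (l.map (simple n)).prod = 1 then ev f else 0)
    {l l' : List (Fin (n - 1))} (hl : l ∈ finNormalWords n)
    (hl' : IsReducedWord n (l'.map (simple n)).prod l') (f : K → R) :
    τ (φ f * (l.map g).prod * (l'.reverse.map g).prod) =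
      if (l.map (simple n)).prod = (l'.map (simple n)).prod then ev f else 0 := by
  induction l' using List.reverseRecOn generalizing l f with
  | nil => simpa using hτ l (isReducedWord_of_mem_finNormalWords hl) f
  | append_singleton l' i ih =>
    have ih := @ih
    have hred := hl'.of_append_singleton
    have hiff : ∀ w v : Equiv.Perm (Fin n), w * simple n i = v ↔ w = v * simple n i := by
      intro w v
      constructor <;> rintro rfl <;> rw [mul_assoc, simple_mul_self, mul_one]
    obtain ⟨l₁, hl₁, ⟨hP, hπ, hlen⟩ | ⟨hP, hπ, hlen⟩⟩ := exists_finNormalWord braid comm hl i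
    · have h1 := ih hl₁ hred f
      rw [hP, hπ] at h1
      simp only [List.reverse_append, List.map_append, List.prod_append, List.reverse_cons,
        List.reverse_nil, List.nil_append, List.map_cons, List.map_nil, List.prod_cons,
        List.prod_nil, mul_one, ← mul_assoc, hiff] at h1 ⊢
      exact h1
    · obtain ⟨e, he⟩ := quad i
      obtain ⟨e', he'⟩ := exists_prod_mul_map hφ l₁ e
      have hmul : (l.map g).prod * g i = (l₁.map g).prod + φ e' * (l.map g).prod := by
        rw [hP, mul_assoc, he, mul_add, mul_one, ← mul_assoc, he', mul_assoc]
      have h1 := ih hl₁ hred f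
      have h2 := ih hl hred (f * e')
      have hne : (l.map (simple n)).prod ≠ (l'.map (simple n)).prod := by
        intro heq
        have h3 := (isReducedWord_of_mem_finNormalWords hl).2 l' heq.symm
        have h4 := hl'.2 l₁ (by simp [← heq, hπ, mul_assoc, simple_mul_self])
        simp at h4
        omega
      rw [if_neg hne] at h2
      simp only [List.reverse_append, List.map_append, List.prod_append, List.reverse_cons,
        List.reverse_nil, List.nil_append, List.map_cons, List.map_nil, List.prod_cons,
        List.prod_nil, mul_one]
      rw [← mul_assoc, mul_assoc (φ f), hmul, mul_add, add_mul, map_add, h1, ← mul_assoc,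
        ← map_mul, h2, add_zero, hπ]
      simp only [mul_left_inj]

lemma span_normalWords_eq_top [Fintype K] [DecidableEq K]
    (hφ : ∀ j f, ∃ f', g j * φ f = φ f' * g j)
    (quad : ∀ j, ∃ e, g j * g j = 1 + φ e * g j)
    (braid : ∀ j k : Fin (n - 1), k.1 = j.1 + 1 → g j * g k * g j = g k * g j * g k)
    (comm : ∀ j k : Fin (n - 1), j.1 + 2 ≤ k.1 → g j * g k = g k * g j)
    (hgen : Algebra.adjoin R (Set.range φ ∪ Set.range g) = ⊤) :
    Submodule.span R (Set.range fun p : K × finNormalWords n =>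
      φ (Pi.single p.1 1) * (p.2.1.map g).prod) = ⊤ := by
  set V := Submodule.span R (Set.range fun p : K × finNormalWords n =>
      φ (Pi.single p.1 1) * (p.2.1.map g).prod)
  have mem : ∀ f, ∀ l ∈ finNormalWords n, φ f * (l.map g).prod ∈ V := by
    intro f l hl
    rw [← AlgHom.toLinearMap_apply, map_eq_sum_smul_single φ.toLinearMap f, Finset.sum_mul]
    refine Submodule.sum_mem _ fun k _ => ?_
    rw [smul_mul_assoc]
    exact V.smul_mem _ (Submodule.subset_span ⟨(k, ⟨l, hl⟩), rfl⟩)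
  have one_mem : (1 : H) ∈ V := by simpa using mem 1 [] nil_mem_finNormalWords
  have mul_mem : ∀ y ∈ Algebra.adjoin R (Set.range φ ∪ Set.range g), ∀ x ∈ V, x * y ∈ V := by
    intro y hy
    induction hy using Algebra.adjoin_induction with
    | mem y hy =>
      intro x hx
      induction hx using Submodule.span_induction with
      | mem x hx =>
        obtain ⟨⟨k, l, hl⟩, rfl⟩ := hx
        rcases hy with ⟨f, rfl⟩ | ⟨i, rfl⟩
        · obtain ⟨f', hf'⟩ := exists_prod_mul_map hφ l f
          simp only [mul_assoc, hf']
          rw [← mul_assoc, ← map_mul]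
          exact mem _ _ hl
        · simp only
          obtain ⟨l₁, hl₁, ⟨hP, -, -⟩ | ⟨hP, -, -⟩⟩ := exists_finNormalWord braid comm hl i
          · rw [mul_assoc, ← hP]
            exact mem _ _ hl₁
          · obtain ⟨e, he⟩ := quad i
            obtain ⟨e', he'⟩ := exists_prod_mul_map hφ l₁ e
            have hmul : (l.map g).prod * g i = (l₁.map g).prod + φ e' * (l.map g).prod := by
              rw [hP, mul_assoc, he, mul_add, mul_one, ← mul_assoc, he', mul_assoc]
            rw [mul_assoc, hmul, mul_add, ← mul_assoc, ← map_mul]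
            exact V.add_mem (mem _ _ hl₁) (mem _ _ hl)
      | zero => simp
      | add x x' _ _ h h' => rw [add_mul]; exact V.add_mem h h'
      | smul c x _ h => rw [smul_mul_assoc]; exact V.smul_mem _ h
    | algebraMap c =>
      intro x hx
      rw [← Algebra.commutes, ← Algebra.smul_def]
      exact V.smul_mem _ hx
    | add y y' _ _ h h' => intro x hx; rw [mul_add]; exact V.add_mem (h x hx) (h' x hx)
    | mul y y' _ _ h h' => intro x hx; rw [← mul_assoc]; exact h' _ (h x hx)
  rw [eq_top_iff]
  intro x _
  simpa using mul_mem x (hgen ▸ Algebra.mem_top) 1 one_mem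

/-- The trace form is non-degenerate as soon as it does not vanish on the primitive idempotents
of the diagonal subalgebra. -/
lemma eq_zero_of_forall_trace_mul_eq_zero [IsDomain R] [Fintype K] [DecidableEq K]
    (hφ : ∀ j f, ∃ f', g j * φ f = φ f' * g j)
    (quad : ∀ j, ∃ e, g j * g j = 1 + φ e * g j)
    (braid : ∀ j k : Fin (n - 1), k.1 = j.1 + 1 → g j * g k * g j = g k * g j * g k)
    (comm : ∀ j k : Fin (n - 1), j.1 + 2 ≤ k.1 → g j * g k = g k * g j)
    (hgen : Algebra.adjoin R (Set.range φ ∪ Set.range g) = ⊤)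
    (τ : H →ₗ[R] R) (htr : ∀ x y, τ (x * y) = τ (y * x)) (ev : (K → R) →ₗ[R] R)
    (hev : ∀ k, ev (Pi.single k 1) ≠ 0)
    (hτ : ∀ l, IsReducedWord n (l.map (simple n)).prod l → ∀ f,
      τ (φ f * (l.map g).prod) = if (l.map (simple n)).prod = 1 then ev f else 0)
    {x : H} (hx : ∀ y, τ (x * y) = 0) : x = 0 := by
  have hmem : x ∈ Submodule.span R (Set.range fun p : K × finNormalWords n =>
      φ (Pi.single p.1 1) * (p.2.1.map g).prod) := by
    rw [span_normalWords_eq_top hφ quad braid comm hgen]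
    trivial
  obtain ⟨c, rfl⟩ := Finsupp.mem_span_range_iff_exists_finsupp.1 hmem
  suffices hc : c = 0 by simp [hc]
  ext ⟨k, l, hl⟩
  have h := hx ((l.reverse.map g).prod * φ (Pi.single k 1))
  rw [← mul_assoc, htr, ← mul_assoc, Finsupp.sum, Finset.mul_sum, Finset.sum_mul, map_sum,
    Finset.sum_eq_single ⟨k, l, hl⟩] at h
  · rw [mul_smul_comm, smul_mul_assoc, map_smul, ← mul_assoc, ← map_mul, ← Pi.single_mul,
      mul_one, trace_prod_mul_prod_reverse hφ quad braid comm τ ev hτ hl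
        (isReducedWord_of_mem_finNormalWords hl), if_pos rfl, smul_eq_mul] at h
    exact (mul_eq_zero.1 h).resolve_right (hev k)
  · rintro ⟨k', l', hl'⟩ - hne
    rw [mul_smul_comm, smul_mul_assoc, map_smul, ← mul_assoc, ← map_mul,
      trace_prod_mul_prod_reverse hφ quad braid comm τ ev hτ hl'
        (isReducedWord_of_mem_finNormalWords hl)]
    split_ifs with heq
    · obtain rfl := finNormalWords_inj hl' hl heq
      have hk : k ≠ k' := fun hk => hne (by rw [hk])
      have h0 : (Pi.single k 1 * Pi.single k' 1 : K → R) = 0 := by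
        ext a
        rcases eq_or_ne a k with rfl | ha
        · simp [hk]
        · simp [ha]
      rw [h0, map_zero, smul_zero]
    · exact smul_zero _
  · intro h0
    rw [Finsupp.notMem_support_iff.1 h0]
    simp

end Pairing

end MAK

namespace MAK

section Lagrange

variable {R : Type*} [CommRing R] {r : ℕ} {u : Fin r → R}

lemma isUnit_sub_of_isUnit_vandermonde
    (h : IsUnit (∏ i : Fin r, ∏ j ∈ Finset.univ.filter (fun j => j < i), (u i - u j)))
    {c c' : Fin r} (hc : c ≠ c') : IsUnit (u c - u c') := by
  have aux : ∀ c c' : Fin r, c' < c → IsUnit (u c - u c') := by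
    intro c c' hlt
    refine isUnit_of_dvd_unit ?_ h
    exact (Finset.dvd_prod_of_mem (fun j => u c - u j) (by simpa using hlt)).trans
      (Finset.dvd_prod_of_mem
        (fun i => ∏ j ∈ Finset.univ.filter (fun j => j < i), (u i - u j)) (Finset.mem_univ c))
  rcases lt_or_gt_of_ne hc with hlt | hlt
  · rw [← neg_sub]
    exact (aux _ _ hlt).neg
  · exact aux _ _ hlt

variable (hu : ∀ c c' : Fin r, c ≠ c' → IsUnit (u c - u c'))
include hu

lemma eval_bpoly (c c' : Fin r) : (bpoly R r u c).eval (u c') = if c' = c then 1 else 0 := by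
  unfold bpoly
  rw [eval_prod]
  split_ifs with h
  · subst h
    refine Finset.prod_eq_one fun j hj => ?_
    have hj : j ≠ c' := (Finset.mem_filter.1 hj).2
    rw [eval_smul, eval_sub, eval_X, eval_C, smul_eq_mul,
      Ring.inverse_mul_cancel _ (hu _ _ hj.symm)]
  · refine Finset.prod_eq_zero (i := c') (by simpa using h) ?_
    simp

omit hu in
lemma natDegree_bpoly_lt (c : Fin r) : (bpoly R r u c).natDegree < r := by
  have h1 : (bpoly R r u c).natDegree ≤
      ∑ j ∈ Finset.univ.filter (fun j => j ≠ c), 1 := by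
    refine (natDegree_prod_le _ _).trans (Finset.sum_le_sum fun j _ => ?_)
    exact (natDegree_smul_le _ _).trans (natDegree_X_sub_C_le _)
  rw [Finset.sum_const, smul_eq_mul, mul_one, Finset.filter_ne', Finset.card_erase_of_mem
    (Finset.mem_univ c), Finset.card_univ, Fintype.card_fin] at h1
  have := c.2
  omega

lemma coeff_zero_bpoly_ne_zero [IsDomain R] (hσ : IsUnit (∏ i : Fin r, u i)) (c : Fin r) :
    (bpoly R r u c).coeff 0 ≠ 0 := by
  unfold bpoly
  rw [coeff_zero_eq_eval_zero, eval_prod, Finset.prod_ne_zero_iff]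
  intro j hj
  have hj : j ≠ c := (Finset.mem_filter.1 hj).2
  have hinv : Ring.inverse (u c - u j) ≠ 0 :=
    ((hu _ _ hj.symm).ringInverse).ne_zero
  have huj : u j ≠ 0 := Finset.prod_ne_zero_iff.1 hσ.ne_zero j (Finset.mem_univ j)
  simpa using ⟨hinv, huj⟩

lemma sum_bpoly [IsDomain R] (hr : 1 ≤ r) : ∑ c, bpoly R r u c = 1 := by
  have hinj : Set.InjOn u (Finset.univ : Finset (Fin r)) := by
    intro c _ c' _ h
    by_contra hne
    exact (hu c c' hne).ne_zero (sub_eq_zero.2 h)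
  refine Polynomial.eq_of_degrees_lt_of_eval_index_eq Finset.univ hinj ?_ ?_ ?_
  · rw [Finset.card_univ, Fintype.card_fin]
    refine (degree_sum_le _ _).trans_lt ((Finset.sup_lt_iff (WithBot.bot_lt_coe r)).2 ?_)
    intro c _
    exact degree_le_natDegree.trans_lt (Nat.cast_lt.2 (natDegree_bpoly_lt c))
  · rw [Finset.card_univ, Fintype.card_fin, degree_one]
    exact_mod_cast hr
  · intro c _
    simp [eval_finsetSum, eval_bpoly hu]

omit hu in
lemma prod_dvd_bpoly_mul (c : Fin r) :
    ∏ c : Fin r, (X - C (u c)) ∣ bpoly R r u c * (X - C (u c)) := by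
  unfold bpoly
  rw [← Finset.mul_prod_erase _ _ (Finset.mem_univ c), Finset.prod_smul, smul_mul_assoc,
    Finset.filter_ne', mul_comm,
    smul_eq_C_mul]
  exact dvd_mul_left _ _

end Lagrange

section Diagonal

open scoped IsMulCommutative in
lemma exists_mvPolynomial_algHom (R : Type*) [CommRing R] {ι H : Type*} [Ring H] [Algebra R H]
    (t : ι → H) (comm : ∀ i j, t i * t j = t j * t i) :
    ∃ ψ : MvPolynomial ι R →ₐ[R] H, ∀ i, ψ (MvPolynomial.X i) = t i := by
  have : IsMulCommutative (Algebra.adjoin R (Set.range t)) := Algebra.isMulCommutative_adjoin R (by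
    rintro _ ⟨i, rfl⟩ _ ⟨j, rfl⟩
    exact comm i j)
  let A := Algebra.adjoin R (Set.range t)
  let x : ι → A := fun i => ⟨t i, Algebra.subset_adjoin ⟨i, rfl⟩⟩
  refine ⟨A.val.comp (MvPolynomial.aeval x), fun i => ?_⟩
  rw [AlgHom.comp_apply, MvPolynomial.aeval_X]
  rfl

/-- The algebra homomorphism attached to a complete family of orthogonal idempotents. -/
noncomputable def idempotentHom {R K H : Type*} [CommRing R] [Fintype K] [Ring H] [Algebra R H]
    {e : K → H} (he : CompleteOrthogonalIdempotents e) : (K → R) →ₐ[R] H :=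
  AlgHom.ofLinearMap (Fintype.linearCombination R e)
    (by simpa [Fintype.linearCombination_apply] using he.complete)
    (by
      classical
      intro f f'
      simp [Fintype.linearCombination_apply, Finset.sum_mul_sum, he.mul_eq,
        smul_smul, mul_comm])

variable {R : Type*} [CommRing R] {n r : ℕ} {u : Fin r → R}

/-- The coordinate function `k ↦ u_{k_i}`. -/
def coord (u : Fin r → R) (i : Fin n) : (Fin n → Fin r) → R := fun k => u (k i)

lemma aeval_coord (i : Fin n) (p : R[X]) :
    aeval (coord u i) p = fun k : Fin n → Fin r => p.eval (u (k i)) := by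
  ext k
  have h := Polynomial.aeval_algHom_apply (Pi.evalAlgHom R (fun _ : Fin n → Fin r => R) k)
    (coord u i) p
  simp only [Pi.evalAlgHom_apply] at h
  rw [← h, coord, ← Polynomial.coe_aeval_eq_eval]

lemma single_eq_prod (hu : ∀ c c' : Fin r, c ≠ c' → IsUnit (u c - u c')) (k : Fin n → Fin r) :
    (Pi.single k 1 : (Fin n → Fin r) → R) =
      ∏ i, aeval (coord u i) (bpoly R r u (k i)) := by
  ext k'
  simp only [aeval_coord, Finset.prod_apply, eval_bpoly hu, Pi.single_apply, Finset.prod_ite_zero,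
    Finset.prod_const_one, funext_iff, Finset.mem_univ, true_imp_iff]

lemma adjoin_coord_eq_top (hu : ∀ c c' : Fin r, c ≠ c' → IsUnit (u c - u c')) :
    Algebra.adjoin R (Set.range (coord (n := n) u)) = ⊤ := by
  rw [eq_top_iff]
  intro f _
  have hf := map_eq_sum_smul_single LinearMap.id f
  simp only [LinearMap.id_apply] at hf
  rw [hf]
  refine Subalgebra.sum_mem _ fun k _ => Subalgebra.smul_mem _ ?_ _
  rw [single_eq_prod hu]
  refine Subalgebra.prod_mem _ fun i _ => ?_
  exact Algebra.adjoin_mono (by simp) (Polynomial.aeval_mem_adjoin_singleton R (coord u i))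

variable {q Δ : Rˣ} {F : Fin r → R[X]}

lemma pim_rel {x y : FA R n} (h : Rel R n r q Δ u F x y) :
    pim R n r q Δ u F x = pim R n r q Δ u F y :=
  RingQuot.mkAlgHom_rel R h

/-- The diagonal subalgebra generated by the `t_i`, as functions on the set of indices. -/
lemma exists_diagonal_algHom [IsDomain R] (hr : 1 ≤ r)
    (hu : ∀ c c' : Fin r, c ≠ c' → IsUnit (u c - u c')) :
    ∃ φ : ((Fin n → Fin r) → R) →ₐ[R] Hnr R n r q Δ u F,
      (∀ i, φ (coord u i) = tt R n r q Δ u F i) ∧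
      (∀ k, φ (Pi.single k 1) = b R n r q Δ u F k) := by
  obtain ⟨ψ, hψ⟩ := exists_mvPolynomial_algHom R (tt R n r q Δ u F) fun i j => by
    simpa only [tt, map_mul] using pim_rel (Rel.tcomm (u := u) i j)
  have hψa : ∀ (i : Fin n) (p : R[X]),
      ψ (aeval (MvPolynomial.X i) p) = aeval (tt R n r q Δ u F i) p := by
    intro i p
    rw [← Polynomial.aeval_algHom_apply, hψ]
  have hzero : ∀ (i : Fin n) (p : R[X]), (∏ c : Fin r, (X - C (u c))) ∣ p →
      ψ (aeval (MvPolynomial.X i) p) = 0 := by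
    rintro i _ ⟨p, rfl⟩
    rw [map_mul, map_mul, hψa, tt, Polynomial.aeval_algHom_apply, pim_rel (Rel.tord i), map_zero,
      zero_mul]
  set e : (Fin n → Fin r) → MvPolynomial (Fin n) R :=
    fun k => ∏ i, aeval (MvPolynomial.X i) (bpoly R r u (k i)) with he
  have hb : ∀ k, b R n r q Δ u F k = ψ (e k) := by
    intro k
    simp only [he, b]
    rw [← List.prod_ofFn, map_list_prod, List.map_ofFn]
    congr 2
    ext i
    exact (hψa _ _).symm
  have hmul : ∀ k i, ψ (e k) * tt R n r q Δ u F i = u (k i) • ψ (e k) := by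
    intro k i
    have h := hzero i _ (prod_dvd_bpoly_mul (k i))
    have h2 : ψ (e k * (MvPolynomial.X i - MvPolynomial.C (u (k i)))) = 0 := by
      rw [he]
      simp only
      rw [← Finset.prod_erase_mul _ _ (Finset.mem_univ i), mul_assoc, map_mul]
      rw [map_mul, map_sub, aeval_X, aeval_C] at h
      rw [show (MvPolynomial.C (u (k i)) : MvPolynomial (Fin n) R) = algebraMap R _ (u (k i))
        from rfl, h, mul_zero]
    rw [mul_sub, map_sub, sub_eq_zero, map_mul, hψ, mul_comm, ← MvPolynomial.smul_eq_C_mul,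
      map_smul] at h2
    exact h2
  have hsum : ∑ k, b R n r q Δ u F k = 1 := by
    simp only [hb]
    rw [← map_sum, ← map_one ψ]
    congr 1
    rw [he]
    have h := Finset.prod_univ_sum (fun _ : Fin n => (Finset.univ : Finset (Fin r)))
      (fun (i : Fin n) (c : Fin r) =>
        aeval (MvPolynomial.X i : MvPolynomial (Fin n) R) (bpoly R r u c))
    rw [Fintype.piFinset_univ] at h
    rw [← h]
    refine Finset.prod_eq_one fun i _ => ?_
    rw [← map_sum (aeval (MvPolynomial.X i)), sum_bpoly hu hr, map_one]
  have hortho : Pairwise fun k k' => b R n r q Δ u F k * b R n r q Δ u F k' = 0 := by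
    intro k k' hne
    obtain ⟨i, hi⟩ := Function.ne_iff.1 hne
    have hdvd : (∏ c : Fin r, (X - C (u c))) ∣ bpoly R r u (k i) * bpoly R r u (k' i) := by
      refine (prod_dvd_bpoly_mul (k i)).trans (mul_dvd_mul_left _ ?_)
      rw [dvd_iff_isRoot, IsRoot, eval_bpoly hu, if_neg hi]
    simp only [hb]
    rw [← map_mul, he]
    simp only
    rw [← Finset.prod_mul_distrib, ← Finset.prod_erase_mul _ _ (Finset.mem_univ i), ← map_mul,
      map_mul ψ, hzero i _ hdvd, mul_zero]
  have hidem : CompleteOrthogonalIdempotents (b R n r q Δ u F) :=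
    CompleteOrthogonalIdempotents.iff_ortho_complete.2 ⟨hortho, hsum⟩
  refine ⟨idempotentHom hidem, fun i => ?_, fun k => ?_⟩
  · have h : tt R n r q Δ u F i = ∑ k, b R n r q Δ u F k * tt R n r q Δ u F i := by
      rw [← Finset.sum_mul, hsum, one_mul]
    rw [h]
    change Fintype.linearCombination R _ _ = _
    rw [Fintype.linearCombination_apply]
    refine Finset.sum_congr rfl fun k _ => ?_
    rw [hb, hmul]
    rfl
  · change Fintype.linearCombination R _ _ = _
    rw [Fintype.linearCombination_apply_single, one_smul]

end Diagonal

end MAK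

namespace MAK

section Twisted

variable {A H : Type*} [CommRing A] [Ring H] (φ : A →+* H)

lemma twisted_braid_expand (s₁ s₂ : A → A) (g₁ g₂ : H) (a b e : A)
    (h₁ : ∀ f, g₁ * φ f = φ (s₁ f) * g₁) (h₂ : ∀ f, g₂ * φ f = φ (s₂ f) * g₂)
    (hq : g₁ * g₁ = 1 + φ e * g₁) :
    (g₁ + φ a) * (g₂ + φ b) * (g₁ + φ a) = g₁ * g₂ * g₁ +
      (φ (s₁ (s₂ a)) * (g₁ * g₂) + φ a * (g₂ * g₁) +
        φ (s₁ b * e + s₁ (b * a) + a * b) * g₁ + φ (a * s₂ a) * g₂ + φ (s₁ b + a * b * a)) := by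
  have t₁ : g₁ * g₂ * φ a = φ (s₁ (s₂ a)) * (g₁ * g₂) := by
    rw [mul_assoc, h₂, ← mul_assoc, h₁, mul_assoc]
  have t₂ : g₁ * φ b * g₁ = φ (s₁ b) + φ (s₁ b * e) * g₁ := by
    rw [h₁, mul_assoc, hq, mul_add, mul_one, map_mul, mul_assoc]
  have t₃ : g₁ * φ b * φ a = φ (s₁ (b * a)) * g₁ := by rw [mul_assoc, ← map_mul, h₁]
  have t₄ : φ a * g₂ * φ a = φ (a * s₂ a) * g₂ := by
    rw [mul_assoc, h₂, ← mul_assoc, map_mul]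
  have expand : ∀ x y : H, (g₁ + x) * (g₂ + y) * (g₁ + x) =
      g₁ * g₂ * g₁ + g₁ * g₂ * x + g₁ * y * g₁ + g₁ * y * x + x * g₂ * g₁ + x * g₂ * x
        + x * y * g₁ + x * y * x := by
    intro x y
    noncomm_ring
  rw [expand, t₁, t₂, t₃, t₄]
  simp only [map_add, map_mul, add_mul, mul_assoc]
  abel

lemma twisted_comm (s₁ s₂ : A → A) (g₁ g₂ : H) (a b : A)
    (h₁ : ∀ f, g₁ * φ f = φ (s₁ f) * g₁) (h₂ : ∀ f, g₂ * φ f = φ (s₂ f) * g₂)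
    (hb : s₁ b = b) (ha : s₂ a = a)
    (h : (g₁ + φ a) * (g₂ + φ b) = (g₂ + φ b) * (g₁ + φ a)) : g₁ * g₂ = g₂ * g₁ := by
  simp only [add_mul, mul_add, h₁, h₂, ha, hb, ← map_mul, mul_comm b a] at h
  have h' : g₁ * g₂ + (φ b * g₁ + φ a * g₂ + φ (a * b))
      = g₂ * g₁ + (φ b * g₁ + φ a * g₂ + φ (a * b)) := by
    convert h using 1 <;> abel
  exact add_right_cancel h'

lemma twisted_quad (s : A → A) (g : H) (a c c' : A)
    (hs : ∀ f, g * φ f = φ (s f) * g) (hc : s c' = c')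
    (ha : a * a = (c - c') * a) (hcc : c * c' = 1)
    (h : (g + φ a - φ c) * (g + φ a + φ c') = 0) :
    g * g = 1 + φ (c - c' - a - s a) * g := by
  have expand : (g + φ a - φ c) * (g + φ a + φ c') = g * g + g * φ a + g * φ c' + φ a * g
      - φ c * g + φ (a * a + a * c' - c * a - c * c') := by
    simp only [map_add, map_sub, map_mul]
    noncomm_ring
  have hzero : a * a + a * c' - c * a - c * c' = -1 := by
    linear_combination ha - hcc
  rw [expand, hzero, hs, hs, hc, map_neg, map_one] at h
  simp only [map_sub, sub_mul]
  rw [← sub_eq_zero, ← h]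
  abel

end Twisted

section Generators

variable {R : Type*} [CommRing R] {n r : ℕ} {u : Fin r → R} {q Δ : Rˣ} {F : Fin r → R[X]}

/-- The action of the simple transposition `s_j` on functions of the indices. -/
def act (j : Fin (n - 1)) (f : (Fin n → Fin r) → R) : (Fin n → Fin r) → R :=
  fun k => f fun i => k (simple n j i)

/-- The function whose value is `q - q⁻¹` on indices with `k_j < k_{j+1}` and `0` elsewhere. -/
def ltFun (q : Rˣ) (j : Fin (n - 1)) : (Fin n → Fin r) → R :=
  fun k => if k (lo n j) < k (hi n j) then (q : R) - ((q⁻¹ : Rˣ) : R) else 0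

/-- The function whose value is `q - q⁻¹` on indices with `k_j = k_{j+1}` and `0` elsewhere. -/
def eqFun (q : Rˣ) (j : Fin (n - 1)) : (Fin n → Fin r) → R :=
  fun k => if k (lo n j) = k (hi n j) then (q : R) - ((q⁻¹ : Rˣ) : R) else 0

lemma simple_lo (j : Fin (n - 1)) : simple n j (lo n j) = hi n j := Equiv.swap_apply_left _ _

lemma simple_hi (j : Fin (n - 1)) : simple n j (hi n j) = lo n j := Equiv.swap_apply_right _ _

lemma simple_of_ne {j : Fin (n - 1)} {i : Fin n} (h₁ : i ≠ lo n j) (h₂ : i ≠ hi n j) :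
    simple n j i = i := Equiv.swap_apply_of_ne_of_ne h₁ h₂

variable {φ : ((Fin n → Fin r) → R) →ₐ[R] Hnr R n r q Δ u F}
  (hcoord : ∀ i, φ (coord u i) = tt R n r q Δ u F i)
  (hb : ∀ k, φ (Pi.single k 1) = b R n r q Δ u F k)

include hcoord in
lemma pim_Bel (hF : ∀ c c' : Fin r, (F c).eval (u c') = if c' = c then (Δ : R) else 0)
    (j : Fin (n - 1)) :
    pim R n r q Δ u F (Bel R n r q Δ u F j) =
      φ (ltFun q j * (coord u (hi n j) - coord u (lo n j))) := by
  have haeval : ∀ (i : Fin n) (c : Fin r), pim R n r q Δ u F (aeval (tf R n i) (F c)) =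
      φ fun k => if k i = c then (Δ : R) else 0 := by
    intro i c
    rw [← Polynomial.aeval_algHom_apply, ← tt, ← hcoord, Polynomial.aeval_algHom_apply,
      aeval_coord]
    simp only [hF]
  have hΔ : ((Δ⁻¹ : Rˣ) : R) * Δ = 1 := Units.inv_mul Δ
  simp only [Bel, map_sum, map_smul, map_mul (pim R n r q Δ u F), haeval]
  simp only [← map_mul φ, ← map_smul φ, ← map_sum φ]
  congr 1
  ext k
  simp only [Finset.sum_apply, Pi.smul_apply, Pi.mul_apply, Pi.sub_apply, smul_eq_mul, ltFun,
    coord]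
  rw [Finset.sum_eq_single (k (hi n j))]
  · rw [Finset.sum_filter, Finset.sum_eq_single (k (lo n j))]
    · simp only [if_true]
      split_ifs
      · linear_combination ((q : R) - ((q⁻¹ : Rˣ) : R)) * (u (k (hi n j)) - u (k (lo n j))) *
          (((Δ⁻¹ : Rˣ) : R) * Δ + 1) * hΔ
      · simp
    · intro c _ hc
      simp [hc.symm]
    · simp
  · intro c _ hc
    simp [hc.symm]
  · simp

include hb in
lemma g_eq (j : Fin (n - 1)) :
    g R n r q Δ u F j = TT R n r q Δ u F j - φ (ltFun q j) := by
  have h : B' R n r q Δ u F (lo n j) (hi n j) = -φ (ltFun q j) := by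
    rw [B', ← AlgHom.toLinearMap_apply, map_eq_sum_smul_single φ.toLinearMap, Finset.smul_sum,
      Finset.sum_filter]
    congr 1
    refine Finset.sum_congr rfl fun k _ => ?_
    rw [AlgHom.toLinearMap_apply, hb, ltFun]
    split_ifs <;> simp
  rw [g, h, sub_eq_add_neg]

include hb in
lemma TT_eq (j : Fin (n - 1)) :
    TT R n r q Δ u F j = g R n r q Δ u F j + φ (ltFun q j) := by
  rw [g_eq hb, sub_add_cancel]

include hcoord hb in
lemma g_mul_tt (hF : ∀ c c' : Fin r, (F c).eval (u c') = if c' = c then (Δ : R) else 0)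
    (j : Fin (n - 1)) (i : Fin n) :
    g R n r q Δ u F j * φ (coord u i) = φ (coord u (simple n j i)) * g R n r q Δ u F j := by
  rw [g_eq hb, sub_mul, mul_sub, ← map_mul, ← map_mul, hcoord, hcoord]
  rcases eq_or_ne i (lo n j) with rfl | h₁
  · have h := pim_rel (Rel.Tlo (q := q) (Δ := Δ) (u := u) (F := F) j)
    rw [map_mul, map_sub, map_mul, pim_Bel hcoord hF] at h
    rw [simple_lo, tt, tt, TT, h, sub_sub, ← map_add]
    congr 2
    ring
  rcases eq_or_ne i (hi n j) with rfl | h₂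
  · have h := pim_rel (Rel.Thi (q := q) (Δ := Δ) (u := u) (F := F) j)
    rw [map_mul, map_add, map_mul, pim_Bel hcoord hF] at h
    have e : ltFun q j * (coord u (hi n j) - coord u (lo n j)) - ltFun q j * coord u (hi n j)
        = -(coord u (lo n j) * ltFun q j) := by ring
    rw [simple_hi, tt, tt, TT, h, add_sub_assoc, ← map_sub, e, map_neg, ← sub_eq_add_neg]
  · have h := pim_rel (Rel.Tt (q := q) (Δ := Δ) (u := u) (F := F) j i h₁ h₂)
    rw [map_mul, map_mul] at h
    rw [simple_of_ne h₁ h₂, tt, TT, h, mul_comm (ltFun q j)]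

include hcoord hb in
lemma g_mul_map (hF : ∀ c c' : Fin r, (F c).eval (u c') = if c' = c then (Δ : R) else 0)
    (hu : ∀ c c' : Fin r, c ≠ c' → IsUnit (u c - u c'))
    (j : Fin (n - 1)) (f : (Fin n → Fin r) → R) :
    g R n r q Δ u F j * φ f = φ (act j f) * g R n r q Δ u F j := by
  have hf : f ∈ Algebra.adjoin R (Set.range (coord (n := n) u)) := by
    rw [adjoin_coord_eq_top hu]
    trivial
  induction hf using Algebra.adjoin_induction with
  | mem f hf =>
    obtain ⟨i, rfl⟩ := hf
    exact g_mul_tt hcoord hb hF j i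
  | algebraMap c =>
    have hact : act j (algebraMap R ((Fin n → Fin r) → R) c) = algebraMap R _ c := rfl
    rw [hact, AlgHom.commutes, Algebra.commutes]
  | add f f' _ _ h h' =>
    have hact : act j (f + f') = act j f + act j f' := rfl
    rw [hact, map_add, map_add, mul_add, add_mul, h, h']
  | mul f f' _ _ h h' =>
    have hact : act j (f * f') = act j f * act j f' := rfl
    rw [hact, map_mul, map_mul, ← mul_assoc, h, mul_assoc, h', mul_assoc]

section Relations

variable (hact : ∀ j f, g R n r q Δ u F j * φ f = φ (act j f) * g R n r q Δ u F j)
include hact hb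

lemma g_mul_self (j : Fin (n - 1)) :
    g R n r q Δ u F j * g R n r q Δ u F j = 1 + φ (eqFun q j) * g R n r q Δ u F j := by
  have h := pim_rel (Rel.quad (r := r) (q := q) (Δ := Δ) (u := u) (F := F) j)
  rw [map_mul, map_sub, map_add, map_zero, AlgHom.commutes, AlgHom.commutes, ← TT, TT_eq hb,
    ← AlgHom.commutes φ, ← AlgHom.commutes φ] at h
  have h' := twisted_quad φ.toRingHom (act j) (g R n r q Δ u F j) (ltFun q j)
    (algebraMap R _ (q : R)) (algebraMap R _ ((q⁻¹ : Rˣ) : R)) (hact j) rfl ?_ ?_ h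
  · refine h'.trans (congrArg (fun f => 1 + φ f * g R n r q Δ u F j) ?_)
    ext k
    simp only [Pi.sub_apply, Pi.algebraMap_apply, Algebra.algebraMap_self_apply, ltFun, eqFun, act,
      simple_lo, simple_hi]
    rcases lt_trichotomy (k (lo n j)) (k (hi n j)) with h | h | h
    · simp [h, h.ne, h.not_gt]
    · simp [h]
    · simp [h, h.ne', h.not_gt]
  · ext k
    simp only [Pi.mul_apply, Pi.sub_apply, Pi.algebraMap_apply, Algebra.algebraMap_self_apply,
      ltFun]
    split_ifs <;> simp
  · rw [← map_mul, Units.mul_inv, map_one]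

lemma g_comm (j k : Fin (n - 1)) (hjk : j.1 + 2 ≤ k.1) :
    g R n r q Δ u F j * g R n r q Δ u F k = g R n r q Δ u F k * g R n r q Δ u F j := by
  have h := pim_rel (Rel.Tcomm (r := r) (q := q) (Δ := Δ) (u := u) (F := F) j k (Or.inl hjk))
  rw [map_mul, map_mul, ← TT, ← TT, TT_eq hb, TT_eq hb] at h
  have aux : ∀ j k : Fin (n - 1), j.1 + 2 ≤ k.1 ∨ k.1 + 2 ≤ j.1 →
      act j (ltFun q k) = (ltFun q k : (Fin n → Fin r) → R) := by
    intro j k hjk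
    have h₁ : simple n j (lo n k) = lo n k := by
      apply simple_of_ne <;> simp [lo, hi, Fin.ext_iff] <;> omega
    have h₂ : simple n j (hi n k) = hi n k := by
      apply simple_of_ne <;> simp [lo, hi, Fin.ext_iff] <;> omega
    ext κ
    simp only [act, ltFun, h₁, h₂]
  exact twisted_comm φ.toRingHom (act j) (act k) _ _ _ _ (hact j) (hact k)
    (aux j k (Or.inl hjk)) (aux k j (Or.inr hjk)) h

lemma g_braid (j k : Fin (n - 1)) (hjk : k.1 = j.1 + 1) :
    g R n r q Δ u F j * g R n r q Δ u F k * g R n r q Δ u F j =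
      g R n r q Δ u F k * g R n r q Δ u F j * g R n r q Δ u F k := by
  have h := pim_rel (Rel.braid (r := r) (q := q) (Δ := Δ) (u := u) (F := F) j k hjk)
  simp only [map_mul] at h
  rw [← TT, ← TT, TT_eq hb, TT_eq hb] at h
  have e₁ := twisted_braid_expand φ.toRingHom (act j) (act k) _ _ (ltFun q j) (ltFun q k) _
    (hact j) (hact k) (g_mul_self hb hact j)
  have e₂ := twisted_braid_expand φ.toRingHom (act k) (act j) _ _ (ltFun q k) (ltFun q j) _
    (hact k) (hact j) (g_mul_self hb hact k)
  have hlk : lo n k = hi n j := Fin.ext hjk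
  have hkl : simple n k (lo n j) = lo n j := by
    apply simple_of_ne <;> simp [lo, hi, Fin.ext_iff] <;> omega
  have hjh : simple n j (hi n k) = hi n k := by
    apply simple_of_ne <;> simp [lo, hi, Fin.ext_iff] <;> omega
  have hkh : simple n k (hi n j) = hi n k := hlk ▸ simple_lo k
  have c₁ : act j (act k (ltFun q j)) = (ltFun q k : (Fin n → Fin r) → R) := by
    ext κ
    simp only [act, ltFun, hlk, simple_lo, hkl, hjh, hkh]
  have c₂ : act k (act j (ltFun q k)) = (ltFun q j : (Fin n → Fin r) → R) := by
    ext κ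
    simp only [act, ltFun, hlk, simple_hi, hkl, hjh]
  have c₃ : act j (ltFun q k) * eqFun q j + act j (ltFun q k * ltFun q j) + ltFun q j * ltFun q k
      = (ltFun q k * act j (ltFun q k) : (Fin n → Fin r) → R) := by
    ext κ
    simp only [act, ltFun, eqFun, hlk, simple_lo, simple_hi, hjh, Pi.add_apply, Pi.mul_apply]
    generalize κ (lo n j) = x
    generalize κ (hi n j) = y
    generalize κ (hi n k) = z
    split_ifs <;> first | omega | ring
  have c₄ : act k (ltFun q j) * eqFun q k + act k (ltFun q j * ltFun q k) + ltFun q k * ltFun q j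
      = (ltFun q j * act k (ltFun q j) : (Fin n → Fin r) → R) := by
    ext κ
    simp only [act, ltFun, eqFun, hlk, hkl, hkh, simple_hi, Pi.add_apply, Pi.mul_apply]
    generalize κ (lo n j) = x
    generalize κ (hi n j) = y
    generalize κ (hi n k) = z
    split_ifs <;> first | omega | ring
  have c₅ : act j (ltFun q k) + ltFun q j * ltFun q k * ltFun q j
      = (act k (ltFun q j) + ltFun q k * ltFun q j * ltFun q k : (Fin n → Fin r) → R) := by
    ext κ
    simp only [act, ltFun, hlk, simple_hi, hkl, hkh, hjh, Pi.add_apply, Pi.mul_apply]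
    generalize κ (lo n j) = x
    generalize κ (hi n j) = y
    generalize κ (hi n k) = z
    split_ifs <;> first | omega | ring
  rw [c₁, c₃, c₅] at e₁
  rw [c₂, c₄] at e₂
  refine add_right_cancel (e₁.symm.trans (h.trans (e₂.trans ?_)))
  abel

omit hact in
lemma adjoin_range_union_range_g (hcoord : ∀ i, φ (coord u i) = tt R n r q Δ u F i) :
    Algebra.adjoin R (Set.range φ ∪ Set.range (g R n r q Δ u F)) = ⊤ := by
  have hpim : Function.Surjective (pim R n r q Δ u F) := RingQuot.mkAlgHom_surjective R _
  rw [eq_top_iff, ← (AlgHom.range_eq_top _).2 hpim, ← Algebra.map_top,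
    ← FreeAlgebra.adjoin_range_ι, AlgHom.map_adjoin, Algebra.adjoin_le_iff]
  rintro _ ⟨_, ⟨i | j, rfl⟩, rfl⟩
  · exact Algebra.subset_adjoin (Or.inl ⟨coord u i, hcoord i⟩)
  · change TT R n r q Δ u F j ∈ _
    rw [TT_eq hb]
    exact add_mem (Algebra.subset_adjoin (Or.inr ⟨j, rfl⟩))
      (Algebra.subset_adjoin (Or.inl ⟨_, rfl⟩))

end Relations

include hcoord in
lemma trace_map_mul_gword [IsDomain R] (hu : ∀ c c' : Fin r, c ≠ c' → IsUnit (u c - u c'))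
    (τ : Hnr R n r q Δ u F →ₗ[R] R)
    (hτ : ∀ c : Fin n → ℕ, (∀ i, c i ≤ r - 1) →
      ∀ (w : Equiv.Perm (Fin n)) (l : List (Fin (n - 1))), IsReducedWord n w l →
        τ (tmon R n r q Δ u F c * gword R n r q Δ u F l) = if w = 1 ∧ c = 0 then 1 else 0)
    {w : Equiv.Perm (Fin n)} {l : List (Fin (n - 1))} (hl : IsReducedWord n w l)
    (f : (Fin n → Fin r) → R) :
    τ (φ f * gword R n r q Δ u F l) =
      if w = 1 then ∑ k, f k * ∏ i, (bpoly R r u (k i)).coeff 0 else 0 := by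
  have htmon : ∀ c : Fin n → ℕ, φ (∏ i, coord u i ^ c i) = tmon R n r q Δ u F c := by
    intro c
    rw [← List.prod_ofFn, map_list_prod, List.map_ofFn, tmon]
    congr 2
    ext i
    rw [Function.comp_apply, map_pow, hcoord]
  have hsingle : ∀ k, τ (φ (Pi.single k 1) * gword R n r q Δ u F l) =
      if w = 1 then ∏ i, (bpoly R r u (k i)).coeff 0 else 0 := by
    intro k
    have hk : (Pi.single k 1 : (Fin n → Fin r) → R) =
        ∑ c ∈ Fintype.piFinset fun _ : Fin n => Finset.range r,
          (∏ i, (bpoly R r u (k i)).coeff (c i)) • ∏ i, coord u i ^ c i := by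
      rw [single_eq_prod hu]
      simp only [aeval_eq_sum_range' (natDegree_bpoly_lt _)]
      rw [Finset.prod_univ_sum]
      exact Finset.sum_congr rfl fun c _ => Finset.prod_smul _ _ _
    rw [hk, map_sum, Finset.sum_mul, map_sum, Finset.sum_eq_single 0]
    · rw [map_smul, smul_mul_assoc, map_smul, htmon, hτ 0 (fun _ => Nat.zero_le _) w l hl]
      simp
    · intro c hc hne
      have hc' : ∀ i, c i ≤ r - 1 := fun i => by
        have := Finset.mem_range.1 (Fintype.mem_piFinset.1 hc i)
        omega
      rw [map_smul, smul_mul_assoc, map_smul, htmon, hτ c hc' w l hl, if_neg fun h => hne h.2,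
        smul_zero]
    · intro h
      refine absurd (Fintype.mem_piFinset.2 fun i => Finset.mem_range.2 ?_) h
      exact (Nat.zero_le _).trans_lt (k i).2
  rw [← AlgHom.toLinearMap_apply, map_eq_sum_smul_single φ.toLinearMap, Finset.sum_mul, map_sum]
  simp only [smul_mul_assoc, map_smul, AlgHom.toLinearMap_apply, hsingle, smul_eq_mul]
  split_ifs <;> simp

end Generators

end MAK


/-- Corollary 4.6: the trace form `τ` is symmetrizing provided `σ_r = u_1⋯u_r`
is invertible in `R`. -/
theorem statement17
    (R : Type*) [CommRing R] [IsDomain R] (n r : ℕ) (hn : 1 ≤ n) (hr : 1 ≤ r)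
    (q Δ : Rˣ) (u : Fin r → R) (F : Fin r → R[X])
    (hΔ : (Δ : R) = ∏ i : Fin r, ∏ j ∈ Finset.univ.filter (fun j => j < i), (u i - u j))
    (hFdeg : ∀ c : Fin r, (F c).degree = ((r - 1 : ℕ) : WithBot ℕ))
    (hFeval : ∀ c c' : Fin r, (F c).eval (u c') = if c' = c then (Δ : R) else 0)
    (hσ : IsUnit (∏ i : Fin r, u i))
    (τ : Hnr R n r q Δ u F →ₗ[R] R)
    (hτ : ∀ c : Fin n → ℕ, (∀ i, c i ≤ r - 1) →
      ∀ (w : Equiv.Perm (Fin n)) (l : List (Fin (n - 1))), IsReducedWord n w l →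
        τ (tmon R n r q Δ u F c * gword R n r q Δ u F l) = if w = 1 ∧ c = 0 then 1 else 0)
    (htr : ∀ x y : Hnr R n r q Δ u F, τ (x * y) = τ (y * x)) :
    (∀ x : Hnr R n r q Δ u F, (∀ y : Hnr R n r q Δ u F, τ (x * y) = 0) → x = 0) ∧
    (∀ y : Hnr R n r q Δ u F, (∀ x : Hnr R n r q Δ u F, τ (x * y) = 0) → y = 0) := by
  have hu : ∀ c c' : Fin r, c ≠ c' → IsUnit (u c - u c') := fun c c' =>
    isUnit_sub_of_isUnit_vandermonde (hΔ ▸ Δ.isUnit)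
  obtain ⟨φ, hcoord, hb⟩ := exists_diagonal_algHom (n := n) (q := q) (Δ := Δ) (F := F) hr hu
  have hact := g_mul_map hcoord hb hFeval hu
  have key : ∀ x : Hnr R n r q Δ u F, (∀ y : Hnr R n r q Δ u F, τ (x * y) = 0) → x = 0 := by
    intro x hx
    refine eq_zero_of_forall_trace_mul_eq_zero (φ := φ) (g := g R n r q Δ u F)
      (fun j f => ⟨_, hact j f⟩) (fun j => ⟨_, g_mul_self hb hact j⟩) (g_braid hb hact)
      (g_comm hb hact) (adjoin_range_union_range_g hb hcoord) τ htr
      (Fintype.linearCombination R fun k => ∏ i, (bpoly R r u (k i)).coeff 0) ?_ ?_ hx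
    · intro k
      rw [Fintype.linearCombination_apply_single, one_smul]
      exact Finset.prod_ne_zero_iff.2 fun i _ => coeff_zero_bpoly_ne_zero hu hσ (k i)
    · exact fun l hl f => trace_map_mul_gword hcoord hu τ hτ hl f
  exact ⟨key, fun y hy => key y fun x => by rw [htr, hy]⟩
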